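/- For all integers m ≥ 2 and t ≥ 1, the corona of complete graphs satisfies π(K_m ⋈ K_t) = m·t + 2m + 2. -/

import Mathlib

/-- A single pebbling move on `G`: remove two pebbles from a vertex `u`
and place one pebble on an adjacent vertex `v`. -/
def PebblingStep {V : Type*} [DecidableEq V] (G : SimpleGraph V) (C C' : V → ℕ) : Prop :=
  ∃ u v, G.Adj u v ∧ 2 ≤ C u ∧
    C' = Function.update (Function.update C u (C u - 2)) v (C v + 1)

/-- Configuration `C` is `k`-fold `r`-solvable on `G`: some sequence of pebbling
moves results in at least `k` pebbles on `r`. -/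
def PebbSolvable {V : Type*} [DecidableEq V] (G : SimpleGraph V) (C : V → ℕ) (r : V)
    (k : ℕ) : Prop :=
  ∃ C', Relation.ReflTransGen (PebblingStep G) C C' ∧ k ≤ C' r

/-- The `k`-fold pebbling number of `G`: the least `n` such that for every root `r`,
every configuration of size at least `n` is `k`-fold `r`-solvable. -/
noncomputable def kPebblingNumber {V : Type*} [Fintype V] [DecidableEq V]
    (G : SimpleGraph V) (k : ℕ) : ℕ :=
  sInf {n | ∀ (r : V) (C : V → ℕ), n ≤ ∑ v, C v → PebbSolvable G C r k}

/-- The pebbling number of `G`. -/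
noncomputable def pebblingNumber {V : Type*} [Fintype V] [DecidableEq V]
    (G : SimpleGraph V) : ℕ :=
  kPebblingNumber G 1

/-- The corona `G ⋈ H`: one copy of `G` and `|G|` disjoint copies of `H`, where the
vertex `g` of `G` is joined to every vertex of its own copy `{g} × V(H)` of `H`. -/
def corona {V W : Type*} (G : SimpleGraph V) (H : SimpleGraph W) :
    SimpleGraph (V ⊕ V × W) :=
  SimpleGraph.fromRel (fun x y =>
    match x, y with
    | Sum.inl g, Sum.inl g' => G.Adj g g'
    | Sum.inl g, Sum.inr (g', _) => g = g'
    | Sum.inr (g, h), Sum.inr (g', h') => g = g' ∧ H.Adj h h'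
    | _, _ => False)

open Finset

section Reachability

variable {V : Type*} [DecidableEq V] {G : SimpleGraph V}

/-- Some sequence of pebbling moves from `C` ends in a configuration dominating `D`. -/
def PebbReaches (G : SimpleGraph V) (C D : V → ℕ) : Prop :=
  ∃ C', Relation.ReflTransGen (PebblingStep G) C C' ∧ D ≤ C'

theorem PebbReaches.of_le {C D : V → ℕ} (h : D ≤ C) : PebbReaches G C D :=
  ⟨C, .refl, h⟩

theorem PebblingStep.apply_eq {C C' : V → ℕ} (h : PebblingStep G C C') :
    ∃ u v, G.Adj u v ∧ 2 ≤ C u ∧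
      ∀ x, C' x + (if x = u then 2 else 0) = C x + (if x = v then 1 else 0) := by
  obtain ⟨u, v, huv, hu, rfl⟩ := h
  refine ⟨u, v, huv, hu, fun x => ?_⟩
  have := huv.ne
  simp only [Function.update_apply]
  split_ifs <;> grind

theorem PebblingStep.add_right {C C' : V → ℕ} (h : PebblingStep G C C') (D : V → ℕ) :
    PebblingStep G (C + D) (C' + D) := by
  obtain ⟨u, v, huv, hu, rfl⟩ := h
  refine ⟨u, v, huv, by simp only [Pi.add_apply]; omega, funext fun x => ?_⟩
  have := huv.ne
  simp only [Function.update_apply, Pi.add_apply]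
  split_ifs <;> grind

theorem pebblingSteps_add_right {C C' : V → ℕ}
    (h : Relation.ReflTransGen (PebblingStep G) C C') (D : V → ℕ) :
    Relation.ReflTransGen (PebblingStep G) (C + D) (C' + D) :=
  h.lift (· + D) fun _ _ hs => hs.add_right D

theorem PebbReaches.trans {C D E : V → ℕ} (h₁ : PebbReaches G C D) (h₂ : PebbReaches G D E) :
    PebbReaches G C E := by
  obtain ⟨C', hC, hD⟩ := h₁
  obtain ⟨D', hD', hE⟩ := h₂
  refine ⟨D' + (C' - D), hC.trans ?_, hE.trans le_self_add⟩
  simpa [add_tsub_cancel_of_le hD] using pebblingSteps_add_right hD' (C' - D)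

theorem PebbReaches.add {C₁ C₂ D₁ D₂ : V → ℕ} (h₁ : PebbReaches G C₁ D₁)
    (h₂ : PebbReaches G C₂ D₂) : PebbReaches G (C₁ + C₂) (D₁ + D₂) := by
  obtain ⟨C₁', s₁, l₁⟩ := h₁
  obtain ⟨C₂', s₂, l₂⟩ := h₂
  refine ⟨C₁' + C₂', (pebblingSteps_add_right s₁ C₂).trans ?_, add_le_add l₁ l₂⟩
  simpa [add_comm] using pebblingSteps_add_right s₂ C₁'

theorem PebbReaches.sum {ι : Type*} (s : Finset ι) {C D : ι → V → ℕ}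
    (h : ∀ i ∈ s, PebbReaches G (C i) (D i)) :
    PebbReaches G (∑ i ∈ s, C i) (∑ i ∈ s, D i) := by
  classical
  induction s using Finset.induction_on with
  | empty => exact .of_le le_rfl
  | insert i s hi ih =>
    rw [sum_insert hi, sum_insert hi]
    exact (h i (mem_insert_self i s)).add (ih fun j hj => h j (mem_insert_of_mem hj))

theorem pebbReaches_single_half {u v : V} (huv : G.Adj u v) (n : ℕ) :
    PebbReaches G (Pi.single u n) (Pi.single v (n / 2)) := by
  induction n using Nat.twoStepInduction with
  | zero => exact .of_le (by simp)
  | one => exact .of_le (by simp)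
  | more n ih _ =>
    have hstep : PebbReaches G (Pi.single u 2) (Pi.single v 1) := by
      refine ⟨Pi.single v 1, .single ⟨u, v, huv, by simp, funext fun x => ?_⟩, le_rfl⟩
      have := huv.ne
      simp only [Function.update_apply, Pi.single_apply]
      split_ifs <;> grind
    rw [Pi.single_add, show (n + 2) / 2 = n / 2 + 1 by omega, Pi.single_add]
    exact ih.add hstep

theorem PebbReaches.pebbSolvable {C : V → ℕ} {r : V} {n k : ℕ}
    (h : PebbReaches G C (Pi.single r n)) (hk : k ≤ n) : PebbSolvable G C r k := by
  obtain ⟨C', hC, hle⟩ := h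
  exact ⟨C', hC, hk.trans (by simpa using hle r)⟩

theorem PebbSolvable.of_le_apply {C : V → ℕ} {r : V} {k : ℕ} (h : k ≤ C r) :
    PebbSolvable G C r k :=
  ⟨C, .refl, h⟩

theorem single_apply_le_self (C : V → ℕ) (v : V) : Pi.single v (C v) ≤ C := by
  intro x
  rw [Pi.single_apply]
  split_ifs with h <;> simp [h]

theorem PebbSolvable.of_adj {C : V → ℕ} {u r : V} (hur : G.Adj u r) (hu : 2 ≤ C u) :
    PebbSolvable G C r 1 :=
  ((PebbReaches.of_le (single_apply_le_self C u)).trans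
    (pebbReaches_single_half hur (C u))).pebbSolvable (by omega)

end Reachability

section Corona

variable {V W : Type*}

@[simp]
theorem corona_adj_inl_inl {G : SimpleGraph V} {H : SimpleGraph W} {g g' : V} :
    (corona G H).Adj (Sum.inl g) (Sum.inl g') ↔ G.Adj g g' := by
  simp only [corona, SimpleGraph.fromRel_adj, ne_eq, Sum.inl.injEq, G.adj_comm g' g, or_self]
  exact ⟨And.right, fun h => ⟨h.ne, h⟩⟩

@[simp]
theorem corona_adj_inl_inr {G : SimpleGraph V} {H : SimpleGraph W} {g : V} {p : V × W} :
    (corona G H).Adj (Sum.inl g) (Sum.inr p) ↔ g = p.1 := by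
  simp [corona]

@[simp]
theorem corona_adj_inr_inl {G : SimpleGraph V} {H : SimpleGraph W} {g : V} {p : V × W} :
    (corona G H).Adj (Sum.inr p) (Sum.inl g) ↔ g = p.1 := by
  rw [SimpleGraph.adj_comm, corona_adj_inl_inr]

@[simp]
theorem corona_adj_inr_inr {G : SimpleGraph V} {H : SimpleGraph W} {p q : V × W} :
    (corona G H).Adj (Sum.inr p) (Sum.inr q) ↔ p.1 = q.1 ∧ H.Adj p.2 q.2 := by
  obtain ⟨g, h⟩ := p
  obtain ⟨g', h'⟩ := q
  simp only [corona, SimpleGraph.fromRel_adj, ne_eq, Sum.inr.injEq, Prod.mk.injEq,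
    H.adj_comm h' h, eq_comm (a := g') (b := g), or_self]
  exact ⟨And.right, fun h => ⟨fun e => h.2.ne e.2, h⟩⟩

variable [Fintype W]

/-- The number of pebbles that direct moves can gather at the core vertex `i`
from its own copy of `W`. -/
def coreLoad (C : V ⊕ V × W → ℕ) (i : V) : ℕ :=
  C (Sum.inl i) + ∑ h, C (Sum.inr (i, h)) / 2

theorem pebbReaches_coreLoad [DecidableEq V] [DecidableEq W] (G : SimpleGraph V)
    (H : SimpleGraph W) (C : V ⊕ V × W → ℕ) (i : V) :
    PebbReaches (corona G H)
      (Pi.single (Sum.inl i) (C (Sum.inl i)) +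
        ∑ h, Pi.single (Sum.inr (i, h)) (C (Sum.inr (i, h))))
      (Pi.single (Sum.inl i) (coreLoad C i)) := by
  have hsum : Pi.single (M := fun _ : V ⊕ V × W => ℕ) (Sum.inl i)
      (∑ h, C (Sum.inr (i, h)) / 2) = ∑ h, Pi.single (Sum.inl i) (C (Sum.inr (i, h)) / 2) :=
    map_sum (AddMonoidHom.single (fun _ : V ⊕ V × W => ℕ) (Sum.inl i)) _ _
  rw [coreLoad, Pi.single_add, hsum]
  exact (PebbReaches.of_le le_rfl).add
    (PebbReaches.sum _ fun h _ => pebbReaches_single_half (by simp) _)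

theorem coreLoad_add_le [DecidableEq V] [DecidableEq W] {C C' : V ⊕ V × W → ℕ} {u v : V ⊕ V × W}
    (h : ∀ x, C' x + (if x = u then 2 else 0) = C x + (if x = v then 1 else 0)) (j : V) :
    coreLoad C' j + (if Sum.inl j = u then 2 else 0) +
        (∑ k : W, if Sum.inr (j, k) = u then 1 else 0) ≤
      coreLoad C j + (if Sum.inl j = v then 1 else 0) +
        (∑ k : W, if Sum.inr (j, k) = v then 1 else 0) := by
  have hblob : ∑ k, (C' (Sum.inr (j, k)) / 2 + if Sum.inr (j, k) = u then 1 else 0) ≤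
      ∑ k, (C (Sum.inr (j, k)) / 2 + if Sum.inr (j, k) = v then 1 else 0) :=
    sum_le_sum fun k _ => by
      have := h (Sum.inr (j, k))
      split_ifs at this ⊢ <;> omega
  rw [sum_add_distrib, sum_add_distrib] at hblob
  have := h (Sum.inl j)
  unfold coreLoad
  omega

variable [Fintype V] [DecidableEq V]

/-- The number of pebbles that direct moves through the core can bring to the core vertex `a`
from outside its own copy of `W`. -/
def coreDelivery (C : V ⊕ V × W → ℕ) (a : V) : ℕ :=
  C (Sum.inl a) + ∑ i ∈ univ.erase a, coreLoad C i / 2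

theorem sum_pebbles_le (C : V ⊕ V × W → ℕ) (a : V) :
    ∑ x, C x + Fintype.card W + 2 ≤ ∑ h, C (Sum.inr (a, h)) +
      Fintype.card V * Fintype.card W + 4 * coreDelivery C a + 2 * Fintype.card V := by
  have hblob (i : V) : C (Sum.inl i) + ∑ h, C (Sum.inr (i, h)) ≤
      4 * (coreLoad C i / 2) + (Fintype.card W + 2) := by
    have h1 : ∑ h, C (Sum.inr (i, h)) ≤ ∑ h : W, (2 * (C (Sum.inr (i, h)) / 2) + 1) :=
      sum_le_sum fun h _ => by omega
    rw [sum_add_distrib, ← mul_sum] at h1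
    simp only [sum_const, card_univ, smul_eq_mul, mul_one] at h1
    unfold coreLoad
    omega
  have hsum := sum_le_sum fun i (_ : i ∈ univ.erase a) => hblob i
  rw [sum_add_distrib (f := fun i => 4 * (coreLoad C i / 2)), ← mul_sum, sum_const,
    card_erase_of_mem (mem_univ a), card_univ, smul_eq_mul] at hsum
  have htotal : ∑ x, C x = ∑ i, (C (Sum.inl i) + ∑ h, C (Sum.inr (i, h))) := by
    rw [Fintype.sum_sum_type, Fintype.sum_prod_type, sum_add_distrib]
  rw [← add_sum_erase _ _ (mem_univ a)] at htotal
  obtain ⟨n, hn⟩ : ∃ n, Fintype.card V = n + 1 :=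
    Nat.exists_eq_succ_of_ne_zero (Fintype.card_pos_iff.2 ⟨a⟩).ne'
  rw [hn] at hsum ⊢
  unfold coreDelivery
  simp only [add_tsub_cancel_right] at hsum
  linarith

theorem coreDelivery_le_of_coreLoad_le {C C' : V ⊕ V × W → ℕ} {a : V}
    (ha : C' (Sum.inl a) = C (Sum.inl a)) (h : ∀ j, coreLoad C' j ≤ coreLoad C j) :
    coreDelivery C' a ≤ coreDelivery C a := by
  unfold coreDelivery
  rw [ha]
  gcongr with j
  exact h j

variable [DecidableEq W]

theorem pebbReaches_coreDelivery (H : SimpleGraph W) (C : V ⊕ V × W → ℕ) (a : V) :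
    PebbReaches (corona ⊤ H) C (Pi.single (Sum.inl a) (coreDelivery C a)) := by
  have hC : C = ∑ i, (Pi.single (Sum.inl i) (C (Sum.inl i)) +
      ∑ h, Pi.single (Sum.inr (i, h)) (C (Sum.inr (i, h)))) := by
    conv_lhs => rw [← univ_sum_single C]
    rw [Fintype.sum_sum_type, Fintype.sum_prod_type, sum_add_distrib]
  have hsum : Pi.single (M := fun _ : V ⊕ V × W => ℕ) (Sum.inl a)
      (∑ i ∈ univ.erase a, coreLoad C i / 2) =
        ∑ i ∈ univ.erase a, Pi.single (Sum.inl a) (coreLoad C i / 2) :=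
    map_sum (AddMonoidHom.single (fun _ : V ⊕ V × W => ℕ) (Sum.inl a)) _ _
  rw [coreDelivery, Pi.single_add, hsum]
  conv => arg 2; rw [hC, ← add_sum_erase _ _ (mem_univ a)]
  refine (PebbReaches.of_le le_self_add).add (PebbReaches.sum _ fun i hi => ?_)
  exact (pebbReaches_coreLoad ⊤ H C i).trans
    (pebbReaches_single_half (by simpa using ne_of_mem_erase hi) _)

theorem pebbSolvable_corona_complete (r : V ⊕ V × W) (C : V ⊕ V × W → ℕ)
    (hC : Fintype.card V * Fintype.card W + 2 * Fintype.card V + 2 ≤ ∑ x, C x) :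
    PebbSolvable (corona (⊤ : SimpleGraph V) (⊤ : SimpleGraph W)) C r 1 := by
  rcases r with a | ⟨a, w⟩
  · by_cases hblob : ∃ h, 2 ≤ C (Sum.inr (a, h))
    · obtain ⟨h, hh⟩ := hblob
      exact .of_adj (u := Sum.inr (a, h)) (by simp) hh
    push Not at hblob
    refine (pebbReaches_coreDelivery ⊤ C a).pebbSolvable ?_
    have hle := sum_pebbles_le C a
    have hs : ∑ h, C (Sum.inr (a, h)) ≤ ∑ _h : W, 1 :=
      sum_le_sum fun h _ => by have := hblob h; omega
    simp only [sum_const, card_univ, smul_eq_mul, mul_one] at hs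
    omega
  · by_cases hr : 1 ≤ C (Sum.inr (a, w))
    · exact .of_le_apply hr
    by_cases hblob : ∃ h, 2 ≤ C (Sum.inr (a, h))
    · obtain ⟨h, hh⟩ := hblob
      have hne : h ≠ w := by rintro rfl; omega
      exact .of_adj (u := Sum.inr (a, h)) (by simpa using hne) hh
    push Not at hblob
    refine ((pebbReaches_coreDelivery ⊤ C a).trans (pebbReaches_single_half
      (v := Sum.inr (a, w)) (by simp) _)).pebbSolvable ?_
    have hle := sum_pebbles_le C a
    have hs : ∑ h, C (Sum.inr (a, h)) + 1 ≤ Fintype.card W := by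
      have h1 : ∑ h, (C (Sum.inr (a, h)) + if h = w then 1 else 0) ≤ ∑ _h : W, 1 :=
        sum_le_sum fun h _ => by
          have := hblob h
          split_ifs with e
          · subst e; omega
          · omega
      simpa [sum_add_distrib] using h1
    omega

/-- The configurations from which neither the copy of `W` at `a` nor the core vertex `a` can be
used to reach the empty vertex `(a, w)`. -/
def IsBlocked (C : V ⊕ V × W → ℕ) (a : V) (w : W) : Prop :=
  (∀ h, C (Sum.inr (a, h)) ≤ 1) ∧ C (Sum.inr (a, w)) = 0 ∧ coreDelivery C a ≤ 1

theorem IsBlocked.step {G : SimpleGraph V} {H : SimpleGraph W} {C C' : V ⊕ V × W → ℕ} {a : V}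
    {w : W} (hC : IsBlocked C a w) (hs : PebblingStep (corona G H) C C') :
    IsBlocked C' a w := by
  obtain ⟨hblob, hr, hD⟩ := hC
  obtain ⟨u, v, huv, hu, hx⟩ := hs.apply_eq
  have hload := coreLoad_add_le hx
  have ha1 : C (Sum.inl a) ≤ 1 := le_trans (Nat.le_add_right _ _) hD
  have hxa := hx (Sum.inl a)
  have hxb := fun h => hx (Sum.inr (a, h))
  suffices (∀ h, C' (Sum.inr (a, h)) = C (Sum.inr (a, h))) ∧
      coreDelivery C' a ≤ coreDelivery C a from
    ⟨fun h => (this.1 h).trans_le (hblob h), (this.1 w).trans hr, this.2.trans hD⟩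
  rcases u with i | ⟨i, p⟩ <;> rcases v with k | ⟨k, q⟩
  · have hik : i ≠ k := (corona_adj_inl_inl.1 huv).ne
    have hia : i ≠ a := by rintro rfl; omega
    refine ⟨fun h => by simpa using hxb h, ?_⟩
    have hhalf : ∑ j ∈ univ.erase a, (coreLoad C' j / 2 + if j = i then 1 else 0) ≤
        ∑ j ∈ univ.erase a, (coreLoad C j / 2 + if j = k then 1 else 0) :=
      sum_le_sum fun j _ => by
        have := hload j
        simp only [Sum.inl.injEq, reduceCtorEq, if_false, sum_const_zero, add_zero] at this
        split_ifs at this ⊢ <;> omega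
    simp only [sum_add_distrib, sum_ite_eq', mem_erase, mem_univ, and_true, ne_eq, hia,
      not_false_eq_true, if_true] at hhalf
    simp only [Sum.inl.injEq] at hxa
    unfold coreDelivery
    split_ifs at hxa hhalf <;> grind
  all_goals
    have hik := huv
    simp only [corona_adj_inl_inr, corona_adj_inr_inl, corona_adj_inr_inr] at hik
    have hia : i ≠ a := by
      rintro rfl
      first
      | omega
      | have := hblob p; omega
    have hka : k ≠ a := by grind
    refine ⟨fun h => by simpa [hia.symm, hka.symm] using hxb h,
      coreDelivery_le_of_coreLoad_le (by simpa [hia.symm, hka.symm] using hxa) fun j => ?_⟩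
    have := hload j
    simp only [Sum.inl.injEq, Sum.inr.injEq, Prod.mk.injEq, reduceCtorEq, if_false,
      sum_const_zero, add_zero, ite_and, sum_ite_irrel, sum_ite_eq', mem_univ, if_true] at this
    split_ifs at this <;> grind

theorem IsBlocked.not_pebbSolvable {G : SimpleGraph V} {H : SimpleGraph W} {C : V ⊕ V × W → ℕ}
    {a : V} {w : W} (hC : IsBlocked C a w) :
    ¬ PebbSolvable (corona G H) C (Sum.inr (a, w)) 1 := by
  rintro ⟨C', hsteps, hr⟩
  have : IsBlocked C' a w := by
    clear hr
    induction hsteps with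
    | refl => exact hC
    | tail _ hs ih => exact ih.step hs
  have := this.2.1
  omega

/-- A largest configuration from which `(a, w)` cannot be reached. -/
def blockedConfig (a b : V) (w : W) : V ⊕ V × W → ℕ
  | Sum.inl _ => 0
  | Sum.inr (i, h) => if h = w then (if i = a then 0 else if i = b then 7 else 3) else 1

theorem isBlocked_blockedConfig (a b : V) (w : W) : IsBlocked (blockedConfig a b w) a w := by
  refine ⟨fun h => ?_, by simp [blockedConfig], ?_⟩
  · simp only [blockedConfig, if_true]
    split_ifs <;> omega
  · have hload (i : V) (hi : i ∈ univ.erase a) :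
        coreLoad (blockedConfig a b w) i / 2 ≤ if i = b then 1 else 0 := by
      have hhalf (h : W) : blockedConfig a b w (Sum.inr (i, h)) / 2 =
          if h = w then (if i = b then 3 else 1) else 0 := by
        simp only [blockedConfig, ne_of_mem_erase hi, if_false]
        split_ifs <;> rfl
      simp only [coreLoad, hhalf, sum_ite_eq', mem_univ, if_true]
      simp only [blockedConfig]
      split_ifs <;> omega
    have hsum := sum_le_sum hload
    rw [sum_ite_eq'] at hsum
    simp only [coreDelivery, blockedConfig] at hsum ⊢
    split_ifs at hsum <;> omega

theorem sum_blockedConfig {a b : V} (hab : a ≠ b) (w : W) :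
    ∑ x, blockedConfig a b w x =
      Fintype.card V * Fintype.card W + 2 * Fintype.card V + 1 := by
  have hblob (i : V) : ∑ h, blockedConfig a b w (Sum.inr (i, h)) + (if i = a then 3 else 0) =
      Fintype.card W + 2 + if i = b then 4 else 0 := by
    have h1 : ∑ h, (blockedConfig a b w (Sum.inr (i, h)) + if h = w then 1 else 0) =
        ∑ h, (1 + if h = w then (if i = a then 0 else if i = b then 7 else 3) else 0) :=
      sum_congr rfl fun h _ => by
        simp only [blockedConfig]
        split_ifs <;> omega
    simp only [sum_add_distrib, sum_ite_eq', mem_univ, if_true, sum_const, card_univ,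
      smul_eq_mul, mul_one] at h1
    split_ifs at h1 ⊢ <;> grind
  have hsum := sum_congr rfl fun i (_ : i ∈ univ) => hblob i
  simp only [sum_add_distrib, sum_ite_eq', mem_univ, if_true, sum_const, card_univ,
    smul_eq_mul] at hsum
  rw [Fintype.sum_sum_type, Fintype.sum_prod_type]
  simp only [blockedConfig, sum_const_zero, zero_add] at hsum ⊢
  linarith

end Corona

/-- For `m ≥ 2` and `t ≥ 1`: `π(K_m ⋈ K_t) = mt + 2m + 2`. -/
theorem pebblingNumber_corona_complete (m t : ℕ) (hm : 2 ≤ m) (ht : 1 ≤ t) :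
    pebblingNumber (corona (⊤ : SimpleGraph (Fin m)) (⊤ : SimpleGraph (Fin t))) =
      m * t + 2 * m + 2 := by
  refine IsLeast.csInf_eq ⟨fun r C hC => ?_, fun n hn => ?_⟩
  · exact pebbSolvable_corona_complete r C (by simpa using hC)
  · by_contra! hlt
    obtain ⟨a, b, hab⟩ := Fin.nontrivial_iff_two_le.2 hm
    refine (isBlocked_blockedConfig a b (⟨0, ht⟩ : Fin t)).not_pebbSolvable (hn _ _ ?_)
    rw [sum_blockedConfig hab]
    simp only [Fintype.card_fin]
    omega
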